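/- Let T be a rooted tree with n nodes and ℓ leaves. Then H(T) ≥ ℓ·log₂ n and H(T) ≥ n − 1. -/

import Mathlib

/-- A rooted tree on a node set `α`, given by its root and parent function
(the root is its own parent, and every node reaches the root by iterating `parent`). -/
structure RTree (α : Type*) where
  root : α
  parent : α → α
  parent_root : parent root = root
  reaches_root : ∀ v, ∃ k, parent^[k] v = root

namespace RTree

variable {α : Type*}

/-- `u` is a (weak) ancestor of `v` in `T`. -/
def ancestor (T : RTree α) (u v : α) : Prop := ∃ k, T.parent^[k] v = u

/-- `u` is a proper ancestor of `v` in `T`. -/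
def properAncestor (T : RTree α) (u v : α) : Prop := T.ancestor u v ∧ u ≠ v

/-- The node set of the subtree `T_v` of `T` rooted at `v`,
i.e. `v` together with all of its descendants. -/
def subtree (T : RTree α) (v : α) : Set α := {u | T.ancestor v u}

/-- A leaf of `T` is a node with no children. -/
def IsLeaf (T : RTree α) (v : α) : Prop := ∀ u, T.parent u = v → u = v

end RTree

/-- The tree entropy `H(T) = Σ_{v ∈ V(T)} log₂(n / |T_v|)`. -/
noncomputable def treeEntropy {α : Type*} [Fintype α] (T : RTree α) : ℝ :=
  ∑ v : α, Real.logb 2 ((Fintype.card α : ℝ) / ((T.subtree v).ncard : ℝ))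

namespace RTree

variable {α : Type*} (T : RTree α)

theorem iterate_parent_root (k : ℕ) : T.parent^[k] T.root = T.root :=
  Function.iterate_fixed T.parent_root k

theorem ancestor_refl (v : α) : T.ancestor v v := ⟨0, rfl⟩

variable {T}

theorem ancestor.trans {u v w : α} (huv : T.ancestor u v) (hvw : T.ancestor v w) :
    T.ancestor u w := by
  obtain ⟨j, rfl⟩ := huv
  obtain ⟨k, rfl⟩ := hvw
  exact ⟨j + k, Function.iterate_add_apply _ _ _ _⟩

theorem ancestor.antisymm {u v : α} (huv : T.ancestor u v) (hvu : T.ancestor v u) : u = v := by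
  obtain ⟨k, hk⟩ := huv
  obtain ⟨j, hj⟩ := hvu
  rcases Nat.eq_zero_or_pos k with rfl | hpos
  · exact hk.symm
  obtain ⟨m, hm⟩ := T.reaches_root v
  have hper : T.parent^[j + k] v = v := by rw [Function.iterate_add_apply, hk, hj]
  have hv : T.parent^[(j + k) * m] v = v := by
    rw [Function.iterate_mul]
    exact Function.iterate_fixed hper m
  have hroot : v = T.root := by
    obtain ⟨d, hd⟩ : ∃ d, (j + k) * m = d + m :=
      ⟨(j + k) * m - m, (Nat.sub_add_cancel (Nat.le_mul_of_pos_left m (by omega))).symm⟩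
    rw [← hv, hd, Function.iterate_add_apply, hm, iterate_parent_root]
  rw [← hk, hroot, iterate_parent_root]

theorem IsLeaf.subtree_eq {v : α} (hv : T.IsLeaf v) : T.subtree v = {v} := by
  ext u
  constructor
  · rintro ⟨k, hk⟩
    induction k with
    | zero => exact hk
    | succ k ih =>
      rw [Function.iterate_succ_apply'] at hk
      exact ih (hv _ hk)
  · rintro rfl
    exact T.ancestor_refl _

variable [Finite α]

variable (T) in
theorem ncard_subtree_pos (v : α) : 0 < (T.subtree v).ncard :=
  (Set.ncard_pos (Set.toFinite _)).2 ⟨v, T.ancestor_refl v⟩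

theorem ncard_subtree_lt {u v : α} (hu : u ∈ T.subtree v) (hne : u ≠ v) :
    (T.subtree u).ncard < (T.subtree v).ncard := by
  refine Set.ncard_lt_ncard ⟨fun w hw => ancestor.trans hu hw, fun h => hne ?_⟩
    (Set.toFinite _)
  exact ancestor.antisymm (h (T.ancestor_refl v)) hu

end RTree

/-- If each value `g v` is at most one more than the number of indices with smaller value,
then the product of the values is at most a factorial. -/
theorem Finset.prod_le_factorial_card {α : Type*} [DecidableEq α] (g : α → ℕ) (s : Finset α)
    (hg : ∀ v ∈ s, g v ≤ (s.filter fun u => g u < g v).card + 1) :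
    ∏ v ∈ s, g v ≤ s.card.factorial := by
  induction s using Finset.induction_on_max_value g with
  | empty => simp
  | insert a s ha hmax ih =>
    rw [Finset.prod_insert ha, Finset.card_insert_of_notMem ha, Nat.factorial_succ]
    refine Nat.mul_le_mul ?_ (ih fun v hv => ?_)
    · have h := hg a (Finset.mem_insert_self a s)
      rw [Finset.filter_insert, if_neg (lt_irrefl _)] at h
      exact h.trans (Nat.succ_le_succ (Finset.card_filter_le _ _))
    · have h := hg v (Finset.mem_insert_of_mem hv)
      rwa [Finset.filter_insert, if_neg (hmax v hv).not_gt] at h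

theorem Nat.pow_succ_add_mul_pow_le (a n : ℕ) :
    a ^ (n + 1) + (n + 1) * a ^ n ≤ (a + 1) ^ (n + 1) := by
  induction n with
  | zero => simp
  | succ n ih =>
    calc a ^ (n + 1 + 1) + (n + 1 + 1) * a ^ (n + 1)
        ≤ (a ^ (n + 1) + (n + 1) * a ^ n) * (a + 1) := by
          ring_nf
          nlinarith [Nat.zero_le (a ^ n), Nat.zero_le (n * a ^ n)]
      _ ≤ (a + 1) ^ (n + 1) * (a + 1) := Nat.mul_le_mul_right _ ih
      _ = (a + 1) ^ (n + 1 + 1) := (pow_succ _ _).symm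

theorem Nat.two_pow_mul_factorial_succ_le (n : ℕ) :
    2 ^ n * (n + 1).factorial ≤ (n + 1) ^ (n + 1) := by
  induction n with
  | zero => simp
  | succ n ih =>
    have h := Nat.pow_succ_add_mul_pow_le (n + 1) n
    calc 2 ^ (n + 1) * (n + 1 + 1).factorial
        = 2 * (2 ^ n * (n + 1).factorial) * (n + 1 + 1) := by
          rw [Nat.factorial_succ (n + 1)]; ring
      _ ≤ 2 * (n + 1) ^ (n + 1) * (n + 1 + 1) := by gcongr
      _ ≤ (n + 1 + 1) ^ (n + 1) * (n + 1 + 1) := by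
          gcongr
          calc 2 * (n + 1) ^ (n + 1) = (n + 1) ^ (n + 1) + (n + 1) * (n + 1) ^ n := by ring
            _ ≤ _ := h
      _ = (n + 1 + 1) ^ (n + 1 + 1) := (pow_succ _ _).symm

theorem RTree.prod_ncard_subtree_le {α : Type*} [Fintype α] (T : RTree α) :
    ∏ v : α, (T.subtree v).ncard ≤ (Fintype.card α).factorial := by
  classical
  refine Finset.prod_le_factorial_card _ _ fun v _ => ?_
  set s := Finset.univ.filter fun u => (T.subtree u).ncard < (T.subtree v).ncard
  have hsub : T.subtree v ⊆ ↑(insert v s) := by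
    intro u hu
    by_cases h : u = v
    · simp [h]
    · simp [s, RTree.ncard_subtree_lt hu h]
  have h := Set.ncard_le_ncard hsub (Set.toFinite _)
  rw [Set.ncard_coe_finset] at h
  exact h.trans (Finset.card_insert_le _ _)

theorem leaves_mul_logb_le_treeEntropy {α : Type*} [Fintype α] (T : RTree α) :
    ({v : α | T.IsLeaf v}.ncard : ℝ) * Real.logb 2 (Fintype.card α : ℝ) ≤ treeEntropy T := by
  classical
  have hcard : {v : α | T.IsLeaf v}.ncard = (Finset.univ.filter fun v => T.IsLeaf v).card := by
    rw [← Set.ncard_coe_finset]; simp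
  rw [hcard, ← nsmul_eq_mul, ← Finset.sum_const, Finset.sum_filter, treeEntropy]
  refine Finset.sum_le_sum fun v _ => ?_
  split_ifs with hv
  · simp [hv.subtree_eq]
  · refine Real.logb_nonneg one_lt_two ?_
    rw [one_le_div (by exact_mod_cast T.ncard_subtree_pos v)]
    have h := Set.ncard_le_card (T.subtree v)
    rw [Nat.card_eq_fintype_card] at h
    exact_mod_cast h

theorem card_sub_one_le_treeEntropy {α : Type*} [Fintype α] (T : RTree α) :
    (Fintype.card α : ℝ) - 1 ≤ treeEntropy T := by
  have : Nonempty α := ⟨T.root⟩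
  have hT := T.prod_ncard_subtree_le
  have hpos : 0 < ∏ v : α, (T.subtree v).ncard :=
    Finset.prod_pos fun v _ => T.ncard_subtree_pos v
  obtain ⟨m, hm⟩ : ∃ m, Fintype.card α = m + 1 :=
    Nat.exists_eq_succ_of_ne_zero Fintype.card_ne_zero
  have hbound : 2 ^ m * ∏ v : α, (T.subtree v).ncard ≤ (m + 1) ^ (m + 1) :=
    (Nat.mul_le_mul_left _ (hm ▸ hT)).trans (Nat.two_pow_mul_factorial_succ_le m)
  have hH : treeEntropy T = Real.logb 2
      (((m + 1 : ℕ) : ℝ) ^ (m + 1) / ((∏ v : α, (T.subtree v).ncard : ℕ) : ℝ)) := by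
    rw [treeEntropy, ← Real.logb_prod]
    · rw [Finset.prod_div_distrib, Finset.prod_const, Finset.card_univ, hm, Nat.cast_prod]
    · intro v _
      have h := T.ncard_subtree_pos v
      rw [hm]
      positivity
  have hposR : (0 : ℝ) < ((∏ v : α, (T.subtree v).ncard : ℕ) : ℝ) := by exact_mod_cast hpos
  rw [hH, Real.le_logb_iff_rpow_le one_lt_two (by positivity), hm, le_div_iff₀ hposR]
  push_cast
  rw [add_sub_cancel_right, Real.rpow_natCast]
  exact_mod_cast hbound

/-- For a rooted tree with `n` nodes and `ℓ` leaves, `H(T) ≥ ℓ·log₂ n` and `H(T) ≥ n − 1`. -/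
theorem treeEntropy_lower_bounds {α : Type*} [Fintype α] (T : RTree α) :
    ({v : α | T.IsLeaf v}.ncard : ℝ) * Real.logb 2 (Fintype.card α : ℝ) ≤ treeEntropy T ∧
      (Fintype.card α : ℝ) - 1 ≤ treeEntropy T :=
  ⟨leaves_mul_logb_le_treeEntropy T, card_sub_one_le_treeEntropy T⟩
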